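/- arXiv:0810.3225 — 3 statements merged into one kernel-verified Lean document; each statement's English description precedes it below -/
import Mathlib

section
/- Each of the eight polynomials z₁ = x₁x₃+x₂x₄, z₂ = x₃⁴-2q x₃²x₄²+x₄⁴, z₃ = x₁⁴+2q x₁²x₂²+x₂⁴, z₄ = x₂x₃³-q x₁x₃²x₄+q x₂x₃x₄²-x₁x₄³, z₅ = x₂³x₃-q x₁²x₂x₃+q x₁x₂²x₄-x₁³x₄, z₆ = x₁⁵x₂-x₁x₂⁵, z₇ = x₃⁵x₄-x₃x₄⁵, z₈ = x₁x₂²x₃³-x₂³x₃²x₄-x₁³x₃x₄²+x₁²x₂x₄³ in ℂ[x₁,x₂,x₃,x₄] is invariant under the linear substitution action of the group Γ (equivalently, under the substitutions given by the generators g₁ and g₂). -/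
/-!
STATEMENT 5: Each of the eight polynomials z₁,…,z₈ of Table 1 is invariant under
the linear substitution action of the group Γ ⊂ GL(4,ℂ) generated by
g₁ = I₂ ⊕ ((I₂)ᵀ)⁻¹ and g₂ = (ωτ) ⊕ (((ωτ)ᵀ)⁻¹).
-/

noncomputable section

open Matrix MvPolynomial

/-- ω = e^{2πi/3} -/
noncomputable def ω : ℂ := Complex.exp (2 * Real.pi * Complex.I / 3)

/-- q = 2ω+1, a square root of -3 -/
noncomputable def q : ℂ := 2 * ω + 1

/-- I₂ = [[i,0],[0,-i]] -/
def I₂ : Matrix (Fin 2) (Fin 2) ℂ := !![Complex.I, 0; 0, -Complex.I]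

/-- τ = -(1/2)·[[1+i, -1+i],[1+i, 1-i]] -/
def τ : Matrix (Fin 2) (Fin 2) ℂ :=
  -(1 / 2 : ℂ) • !![1 + Complex.I, -1 + Complex.I; 1 + Complex.I, 1 - Complex.I]

/-- the block-diagonal 4×4 matrix A ⊕ D -/
def blockDiag (A D : Matrix (Fin 2) (Fin 2) ℂ) : Matrix (Fin 4) (Fin 4) ℂ :=
  Matrix.reindex finSumFinEquiv finSumFinEquiv (Matrix.fromBlocks A 0 0 D)

/-- g₁ = I₂ ⊕ ((I₂)ᵀ)⁻¹ -/
noncomputable def g₁ : Matrix (Fin 4) (Fin 4) ℂ := blockDiag I₂ ((I₂ᵀ)⁻¹)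

/-- g₂ = (ωτ) ⊕ (((ωτ)ᵀ)⁻¹) -/
noncomputable def g₂ : Matrix (Fin 4) (Fin 4) ℂ := blockDiag (ω • τ) (((ω • τ)ᵀ)⁻¹)

/-- linear substitution of variables by a matrix M : xⱼ ↦ ∑ᵢ Mⱼᵢ xᵢ -/
noncomputable def subst (M : Matrix (Fin 4) (Fin 4) ℂ) :
    MvPolynomial (Fin 4) ℂ →ₐ[ℂ] MvPolynomial (Fin 4) ℂ :=
  MvPolynomial.aeval fun j => ∑ i, MvPolynomial.C (M j i) * MvPolynomial.X i

/-- the eight basic invariants of Table 1 (variables x₁,x₂,x₃,x₄ = X 0, X 1, X 2, X 3) -/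
noncomputable def z : Fin 8 → MvPolynomial (Fin 4) ℂ :=
  ![X 0 * X 2 + X 1 * X 3,
    X 2 ^ 4 - C (2 * q) * X 2 ^ 2 * X 3 ^ 2 + X 3 ^ 4,
    X 0 ^ 4 + C (2 * q) * X 0 ^ 2 * X 1 ^ 2 + X 1 ^ 4,
    X 1 * X 2 ^ 3 - C q * X 0 * X 2 ^ 2 * X 3 + C q * X 1 * X 2 * X 3 ^ 2 - X 0 * X 3 ^ 3,
    X 1 ^ 3 * X 2 - C q * X 0 ^ 2 * X 1 * X 2 + C q * X 0 * X 1 ^ 2 * X 3 - X 0 ^ 3 * X 3,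
    X 0 ^ 5 * X 1 - X 0 * X 1 ^ 5,
    X 2 ^ 5 * X 3 - X 2 * X 3 ^ 5,
    X 0 * X 1 ^ 2 * X 2 ^ 3 - X 1 ^ 3 * X 2 ^ 2 * X 3 - X 0 ^ 3 * X 2 * X 3 ^ 2
      + X 0 ^ 2 * X 1 * X 3 ^ 3]

theorem omega_sq : ω ^ 2 = -ω - 1 := by
  have h : IsPrimitiveRoot ω 3 := by
    have := Complex.isPrimitiveRoot_exp 3 (by norm_num)
    simpa [ω] using this
  have h1 := h.geom_sum_eq_zero (by norm_num)
  simp [Finset.sum_range_succ] at h1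
  linear_combination h1

theorem subst_mul (M N : Matrix (Fin 4) (Fin 4) ℂ) (p : MvPolynomial (Fin 4) ℂ) :
    subst (N * M) p = subst M (subst N p) := by
  have : subst (N * M) = (subst M).comp (subst N) := by
    apply MvPolynomial.algHom_ext
    intro j
    simp [subst, Matrix.mul_apply, Fin.sum_univ_four, 
      MvPolynomial.algebraMap_eq]
    ring
  rw [this]; rfl

theorem subst_one (p : MvPolynomial (Fin 4) ℂ) : subst 1 p = p := by
  have : subst 1 = AlgHom.id ℂ _ := by
    apply MvPolynomial.algHom_ext
    intro j
    simp [subst, Matrix.one_apply]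
  rw [this]; rfl

theorem g1_eq : g₁ = !![Complex.I, 0, 0, 0; 0, -Complex.I, 0, 0;
    0, 0, -Complex.I, 0; 0, 0, 0, Complex.I] := by
  have h : (I₂ᵀ)⁻¹ = !![-Complex.I, 0; 0, Complex.I] := by
    apply Matrix.inv_eq_right_inv
    ext i j
    fin_cases i <;> fin_cases j <;> simp [I₂, Matrix.mul_apply]
  rw [g₁, h]
  ext i j
  fin_cases i <;> fin_cases j <;>
    simp [_root_.blockDiag, I₂, Matrix.fromBlocks, finSumFinEquiv, Fin.addCases]

/-- the scalar of the first block of `g₂` -/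
def sc : ℂ := -(1 / 2) * (1 + Complex.I) * ω
/-- the scalar of the second block of `g₂` -/
def tc : ℂ := (1 / 2) * (1 - Complex.I) * (1 + ω)

theorem g2_eq : g₂ = !![sc, sc * Complex.I, 0, 0; sc, -(sc * Complex.I), 0, 0;
    0, 0, tc, -(tc * Complex.I); 0, 0, tc, tc * Complex.I] := by
  have hI : Complex.I ^ 2 = -1 := Complex.I_sq
  have hw := omega_sq
  have h : ((ω • τ)ᵀ)⁻¹ = !![tc, -(tc * Complex.I); tc, tc * Complex.I] := by
    apply Matrix.inv_eq_right_inv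
    ext i j
    fin_cases i <;> fin_cases j <;> simp [τ, tc, Matrix.mul_apply, Fin.sum_univ_two] <;> grind
  rw [g₂, h]
  ext i j
  fin_cases i <;> fin_cases j <;>
    simp [_root_.blockDiag, τ, sc, Matrix.fromBlocks, finSumFinEquiv, Fin.addCases] <;> grind

theorem inv_g1 (k : Fin 8) : subst g₁ (z k) = z k := by
  have hI : (C Complex.I : MvPolynomial (Fin 4) ℂ) ^ 2 = -1 := by
    rw [← C_pow, Complex.I_sq]; simp
  rw [g1_eq]
  fin_cases k <;>
    simp [subst, z, Fin.sum_univ_four, MvPolynomial.algebraMap_eq] <;> grind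

theorem inv_g2 (k : Fin 8) : subst g₂ (z k) = z k := by
  have hI0 : Complex.I ^ 2 = -1 := Complex.I_sq
  have hw := omega_sq
  have hI : (C Complex.I : MvPolynomial (Fin 4) ℂ) ^ 2 = -1 := by
    rw [← C_pow, Complex.I_sq]; simp
  have hW : (C ω : MvPolynomial (Fin 4) ℂ) ^ 2 = - C ω - 1 := by
    rw [← C_pow, omega_sq]; simp
  have hst : (C sc * C tc : MvPolynomial (Fin 4) ℂ) = C (1 / 2) := by
    rw [← C_mul]; congr 1; simp only [sc, tc]; grind
  have hs4 : (C sc : MvPolynomial (Fin 4) ℂ) ^ 4 = - C (1 / 4) * C ω := by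
    rw [← C_pow, ← C_neg, ← C_mul]; congr 1; simp only [sc]; grind
  have hs6 : (C sc : MvPolynomial (Fin 4) ℂ) ^ 6 = - C (1 / 8) * C Complex.I := by
    rw [← C_pow, ← C_neg, ← C_mul]; congr 1; simp only [sc]; grind
  have ht4 : (C tc : MvPolynomial (Fin 4) ℂ) ^ 4 = C (1 / 4) * (1 + C ω) := by
    rw [← C_pow, ← C_1, ← C_add, ← C_mul]; congr 1; simp only [tc]; grind
  have ht6 : (C tc : MvPolynomial (Fin 4) ℂ) ^ 6 = C (1 / 8) * C Complex.I := by
    rw [← C_pow, ← C_mul]; congr 1; simp only [tc]; grind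
  have hs2 : (C sc : MvPolynomial (Fin 4) ℂ) ^ 2 = - C (1 / 2) * C Complex.I * (1 + C ω) := by
    rw [← C_pow, ← C_1, ← C_add, ← C_neg, ← C_mul, ← C_mul]; congr 1; simp only [sc]; grind
  have ht2 : (C tc : MvPolynomial (Fin 4) ℂ) ^ 2 = - C (1 / 2) * C Complex.I * C ω := by
    rw [← C_pow, ← C_neg, ← C_mul, ← C_mul]; congr 1; simp only [tc]; grind
  have h2 : (2 : MvPolynomial (Fin 4) ℂ) * C (1 / 2) = 1 := by
    rw [← C_1, show (2 : MvPolynomial (Fin 4) ℂ) = C 2 from rfl, ← C_mul]; norm_num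
  have h4 : (C (1 / 4) : MvPolynomial (Fin 4) ℂ) = C (1 / 2) ^ 2 := by
    rw [← C_pow]; norm_num
  have h8 : (C (1 / 8) : MvPolynomial (Fin 4) ℂ) = C (1 / 2) ^ 3 := by
    rw [← C_pow]; norm_num
  have hq : (C q : MvPolynomial (Fin 4) ℂ) = 2 * C ω + 1 := by
    simp only [q, C_add, C_mul, C_1]; rfl
  have hC2 : (C 2 : MvPolynomial (Fin 4) ℂ) = 2 := rfl
  rw [h4] at hs4 ht4
  rw [h8] at hs6 ht6
  rw [g2_eq]
  generalize (C (1 / 2) : MvPolynomial (Fin 4) ℂ) = e at *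
  fin_cases k <;>
    simp [subst, z, Fin.sum_univ_four, MvPolynomial.algebraMap_eq] <;>
    (try simp only [hq, hC2]) <;>
    clear h4 h8 hI0 hw hq hC2 <;>
    generalize (C sc : MvPolynomial (Fin 4) ℂ) = s at * <;>
    generalize (C tc : MvPolynomial (Fin 4) ℂ) = t at * <;>
    generalize (C ω : MvPolynomial (Fin 4) ℂ) = w at * <;>
    generalize (C Complex.I : MvPolynomial (Fin 4) ℂ) = i at * <;>
    generalize (X 0 : MvPolynomial (Fin 4) ℂ) = a at * <;>
    generalize (X 1 : MvPolynomial (Fin 4) ℂ) = b at * <;>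
    generalize (X 2 : MvPolynomial (Fin 4) ℂ) = c at * <;>
    generalize (X 3 : MvPolynomial (Fin 4) ℂ) = d at * <;>
    grind

theorem basic_invariants_are_invariant
    (G₁ G₂ : GL (Fin 4) ℂ)
    (hG₁ : (G₁ : Matrix (Fin 4) (Fin 4) ℂ) = g₁)
    (hG₂ : (G₂ : Matrix (Fin 4) (Fin 4) ℂ) = g₂) :
    ∀ k : Fin 8, ∀ g ∈ Subgroup.closure {G₁, G₂},
      subst (g : Matrix (Fin 4) (Fin 4) ℂ) (z k) = z k := by
  intro k g hg
  induction hg using Subgroup.closure_induction with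
  | mem x hx =>
    rcases hx with rfl | rfl
    · rw [hG₁]; exact inv_g1 k
    · rw [hG₂]; exact inv_g2 k
  | one => exact subst_one _
  | mul x y _ _ hx hy => rw [Units.val_mul, subst_mul, hx, hy]
  | inv x _ hx =>
    have h := subst_mul ((x⁻¹ : GL (Fin 4) ℂ) : Matrix (Fin 4) (Fin 4) ℂ)
      (x : Matrix (Fin 4) (Fin 4) ℂ) (z k)
    rw [hx, ← Units.val_mul, mul_inv_cancel, Units.val_one, subst_one] at h
    exact h.symm

end
end

section
/- Each of the nine polynomials p₁ = q z₁³z₅ - z₁z₃z₄ - 2z₂z₆ - z₅z₈, p₂ = z₁z₅² + 2z₄z₆ + z₃z₈, p₃ = q z₁³z₄ + z₁z₂z₅ - 2z₃z₇ - z₄z₈, p₄ = z₁z₄² - 2z₅z₇ - z₂z₈, p₅ = -z₁⁴ + z₂z₃ - z₄z₅ - 3q z₁z₈, p₆ = q z₁²z₃z₅ - 2z₁³z₆ - z₃²z₄ + z₅³ - 6q z₆z₈, p₇ = z₁²z₄z₅ + q z₁³z₈ + 4z₆z₇ - z₈², p₈ = q z₁²z₂z₄ - 2z₁³z₇ - z₄³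 + z₂²z₅ - 6q z₇z₈, p₉ = 4z₁²z₄z₅ + q z₃z₄² - q z₂z₅² + 4z₆z₇ + 8z₈² lies in the kernel of the ℂ-algebra homomorphism φ : ℂ[z₁,…,z₈] → ℂ[x₁,x₂,x₃,x₄] defined by substituting the invariants of Table 1; that is, each pᵢ becomes identically zero after the substitution. -/
noncomputable section

open MvPolynomial

/-- φ : ℂ[z₁,…,z₈] → ℂ[x₁,x₂,x₃,x₄], the ℂ-algebra homomorphism substituting the
eight basic invariants of Table 1 (zₖ = X (k-1)) -/
noncomputable def φ : MvPolynomial (Fin 8) ℂ →ₐ[ℂ] MvPolynomial (Fin 4) ℂ :=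
  MvPolynomial.aeval z

/-- the nine generators of Table 2 (variables z₁,…,z₈ = X 0, …, X 7) -/
noncomputable def p : Fin 9 → MvPolynomial (Fin 8) ℂ :=
  ![C q * X 0 ^ 3 * X 4 - X 0 * X 2 * X 3 - 2 * X 1 * X 5 - X 4 * X 7,
    X 0 * X 4 ^ 2 + 2 * X 3 * X 5 + X 2 * X 7,
    C q * X 0 ^ 3 * X 3 + X 0 * X 1 * X 4 - 2 * X 2 * X 6 - X 3 * X 7,
    X 0 * X 3 ^ 2 - 2 * X 4 * X 6 - X 1 * X 7,
    -X 0 ^ 4 + X 1 * X 2 - X 3 * X 4 - C (3 * q) * X 0 * X 7,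
    C q * X 0 ^ 2 * X 2 * X 4 - 2 * X 0 ^ 3 * X 5 - X 2 ^ 2 * X 3 + X 4 ^ 3
      - C (6 * q) * X 5 * X 7,
    X 0 ^ 2 * X 3 * X 4 + C q * X 0 ^ 3 * X 7 + 4 * X 5 * X 6 - X 7 ^ 2,
    C q * X 0 ^ 2 * X 1 * X 3 - 2 * X 0 ^ 3 * X 6 - X 3 ^ 3 + X 1 ^ 2 * X 4
      - C (6 * q) * X 6 * X 7,
    4 * X 0 ^ 2 * X 3 * X 4 + C q * X 2 * X 3 ^ 2 - C q * X 1 * X 4 ^ 2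
      + 4 * X 5 * X 6 + 8 * X 7 ^ 2]

/-!
STATEMENT 7: Each of the nine polynomials p₁,…,p₉ of Table 2 lies in the kernel of
the ℂ-algebra homomorphism φ : ℂ[z₁,…,z₈] → ℂ[x₁,x₂,x₃,x₄] substituting the
invariants of Table 1; i.e. each pᵢ becomes identically zero after substitution.
-/

theorem q_sq : q ^ 2 = -3 := by
  have h3 : ω ^ 3 = 1 := by
    rw [ω, ← Complex.exp_nat_mul, ← Complex.exp_two_pi_mul_I]
    congr 1
    push_cast
    ring
  have h1 : ω ≠ 1 := by
    intro h
    rw [ω, Complex.exp_eq_one_iff] at h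
    obtain ⟨n, hn⟩ := h
    have hn2 : (2 * Real.pi * Complex.I) * (1 - 3 * (n : ℂ)) = 0 := by
      linear_combination 3 * hn
    rcases mul_eq_zero.mp hn2 with h | h
    · exact Complex.two_pi_I_ne_zero h
    · have : (1 : ℤ) - 3 * n = 0 := by exact_mod_cast h
      omega
  have h2 : ω ^ 2 + ω + 1 = 0 := by
    have : (ω - 1) * (ω ^ 2 + ω + 1) = 0 := by linear_combination h3
    exact (mul_eq_zero.mp this).resolve_left (sub_ne_zero.mpr h1)
  rw [q]
  linear_combination 4 * h2

theorem relations_in_kernel : ∀ k : Fin 9, φ (p k) = 0 := by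
  have hC (n : ℕ) [n.AtLeastTwo] :
      (C (OfNat.ofNat n : ℂ) : MvPolynomial (Fin 4) ℂ) = OfNat.ofNat n := map_ofNat C n
  have hB (n : ℕ) [n.AtLeastTwo] (f : Fin 8 → MvPolynomial (Fin 4) ℂ) :
      bind₁ f (OfNat.ofNat n : MvPolynomial (Fin 8) ℂ) = OfNat.ofNat n := map_ofNat (bind₁ f) n
  have hq : (C q : MvPolynomial (Fin 4) ℂ) ^ 2 + 3 = 0 := by
    rw [← C_pow, q_sq, C_neg, hC 3]
    ring
  intro k
  fin_cases k <;> simp [φ, p, z, algebraMap_eq, hB, hC]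
  · linear_combination ((-1)*X 0^5*X 1*X 2^4 + (1)*X 0*X 1^5*X 3^4) * hq
  · linear_combination ((1)*X 0^5*X 1^2*X 2^3 + (-1)*X 0^4*X 1^3*X 2^2*X 3 + (-1)*X 0^3*X 1^4*X 2*X 3^2 + (1)*X 0^2*X 1^5*X 3^3) * hq
  · linear_combination ((-1)*X 0^4*X 2^5*X 3 + (1)*X 1^4*X 2*X 3^5) * hq
  · linear_combination ((1)*X 0^3*X 2^5*X 3^2 + (-1)*X 0^2*X 1*X 2^4*X 3^3 + (-1)*X 0*X 1^2*X 2^3*X 3^4 + (1)*X 1^3*X 2^2*X 3^5) * hq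
  · linear_combination ((-2)*X 0^2*X 1^2*X 2^2*X 3^2 + (-1)*X 0^3*X 1*X 2^3*X 3 + (-1)*X 0*X 1^3*X 2*X 3^3) * hq
  · linear_combination ((-1)*X 0^8*X 1*X 2^3 + (-2)*X 0^7*X 1^2*X 2^2*X 3 + (-3)*C q*X 0^6*X 1^3*X 2^3 + (5)*C q*X 0^5*X 1^4*X 2^2*X 3 + (1)*X 0^3*X 1^6*X 2^2*X 3 + (-1)*X 0^6*X 1^3*X 2*X 3^2 + (-5)*C q*X 0^4*X 1^5*X 2*X 3^2 + (2)*X 0^2*X 1^7*X 2*X 3^2 + (3)*C q*X 0^3*X 1^6*X 3^3 + (1)*X 0*X 1^8*X 3^3) * hq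
  · linear_combination ((1)*X 0^5*X 1*X 2^5*X 3 + (-2)*X 0^3*X 1^3*X 2^3*X 3^3 + (1)*X 0*X 1^5*X 2*X 3^5) * hq
  · linear_combination ((-1)*X 0^3*X 2^8*X 3 + (-2)*X 0^2*X 1*X 2^7*X 3^2 + (3)*C q*X 0^3*X 2^6*X 3^3 + (-5)*C q*X 0^2*X 1*X 2^5*X 3^4 + (1)*X 0^2*X 1*X 2^3*X 3^6 + (-1)*X 0*X 1^2*X 2^6*X 3^3 + (5)*C q*X 0*X 1^2*X 2^4*X 3^5 + (2)*X 0*X 1^2*X 2^2*X 3^7 + (-3)*C q*X 1^3*X 2^3*X 3^6 + (1)*X 1^3*X 2*X 3^8) * hq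
  · linear_combination ((8)*X 0^3*X 1^3*X 2^3*X 3^3 + (-8)*X 0^4*X 1^2*X 2^4*X 3^2 + (1)*C q*X 0^6*X 2^4*X 3^2 + (2)*C q*X 0^5*X 1*X 2^3*X 3^3 + (4)*X 0^6*X 2^2*X 3^4 + (-4)*X 0^5*X 1*X 2*X 3^5 + (4)*X 0^2*X 1^4*X 2^6 + (-2)*C q*X 0^3*X 1^3*X 2^5*X 3 + (4)*C q^2*X 0^4*X 1^2*X 2^4*X 3^2 + (-8)*C q^2*X 0^3*X 1^3*X 2^3*X 3^3 + (4)*C q^2*X 0^2*X 1^4*X 2^2*X 3^4 + (-2)*C q*X 0^3*X 1^3*X 2*X 3^5 + (4)*X 0^4*X 1^2*X 3^6 + (-4)*X 0*X 1^5*X 2^5*X 3 + (4)*X 1^6*X 2^4*X 3^2 + (2)*C q*X 0*X 1^5*X 2^3*X 3^3 + (-8)*X 0^2*X 1^4*X 2^2*X 3^4 + (1)*C q*X 1^6*X 2^2*X 3^4 + (-1)*C q*X 0^4*X 1^2*X 2^6 + (-1)*C q*X 0^2*X 1^4*X 3^6) * hq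

end
end

section
/- The kernel of the ℂ-algebra homomorphism φ : ℂ[z₁,…,z₈] → ℂ[x₁,x₂,x₃,x₄] substituting the eight basic invariants equals the ideal generated by the nine polynomials p₁ = q z₁³z₅ - z₁z₃z₄ - 2z₂z₆ - z₅z₈, p₂ = z₁z₅² + 2z₄z₆ + z₃z₈, p₃ = q z₁³z₄ + z₁z₂z₅ - 2z₃z₇ - z₄z₈, p₄ = z₁z₄² - 2z₅z₇ - z₂z₈, p₅ = -z₁⁴ + z₂z₃ - z₄z₅ - 3q z₁z₈, p₆ = q z₁²z₃z₅ - 2z₁³z₆ - z₃²z₄ + z₅³ - 6q z₆z₈, p₇ = z₁²z₄z₅ + q z₁³z₈ + 4z₆z₇ - z₈², p₈ = q z₁²z₂z₄ - 2z₁³z₇ - z₄³ + z₂²z₅ - 6q z₇z₈, p₉ = 4z₁²z₄z₅ + q z₃z₄² - q z₂z₅² + 4z₆z₇ + 8z₈². -/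
noncomputable section

open MvPolynomial

/-!
STATEMENT 8: The kernel of the ℂ-algebra homomorphism φ : ℂ[z₁,…,z₈] → ℂ[x₁,…,x₄]
substituting the eight basic invariants equals the ideal generated by the nine
polynomials p₁,…,p₉ of Table 2.
-/


/-! ### Scroll monomials in a commutative ring -/

section scroll

variable {A : Type*} [CommRing A]

/-- raise `X0` to `X1` as often as possible, then pass the rest on to `Y` -/
def scrE (X0 X1 : A) (a : ℕ) (Y : ℕ → A) (s : ℕ) : A :=
  X1 ^ (min s a) * X0 ^ (a - s) * Y (s - a)

/-- the canonical monomial of degree `m` and height `s` in the conic part -/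
def scrG (G0 G1 G2 : A) (m s : ℕ) : A :=
  G0 ^ (m - (s + 1) / 2) * G1 ^ (s % 2) * G2 ^ (s / 2)

theorem scrG_swap {X0 X1 G0 G1 G2 : A} (h1 : X0 * G1 = X1 * G0) (h2 : X0 * G2 = X1 * G1)
    (m s : ℕ) (hs : s + 1 ≤ 2 * m) : X0 * scrG G0 G1 G2 m (s + 1) = X1 * scrG G0 G1 G2 m s := by
  unfold scrG
  obtain ⟨k, rfl | rfl⟩ := Nat.even_or_odd' s
  · obtain ⟨d, rfl⟩ : ∃ d, m = k + 1 + d := ⟨m - (k + 1), by omega⟩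
    have e1 : k + 1 + d - (2 * k + 1 + 1) / 2 = d := by omega
    have e2 : (2 * k + 1) % 2 = 1 := by omega
    have e3 : (2 * k + 1) / 2 = k := by omega
    have e4 : k + 1 + d - k = d + 1 := by omega
    have e5 : (2 * k) % 2 = 0 := by omega
    have e6 : (2 * k) / 2 = k := by omega
    rw [e1, e2, e3, e4, e5, e6]
    linear_combination G0 ^ d * G2 ^ k * h1
  · obtain ⟨d, rfl⟩ : ∃ d, m = k + 1 + d := ⟨m - (k + 1), by omega⟩
    have e1 : k + 1 + d - (2 * k + 1 + 1 + 1) / 2 = d := by omega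
    have e2 : (2 * k + 1 + 1) % 2 = 0 := by omega
    have e3 : (2 * k + 1 + 1) / 2 = k + 1 := by omega
    have e4 : k + 1 + d - (k + 1) = d := by omega
    have e5 : (2 * k + 1) % 2 = 1 := by omega
    have e6 : (2 * k + 1) / 2 = k := by omega
    rw [e1, e2, e3, e4, e5, e6]
    linear_combination G0 ^ d * G2 ^ k * h2

theorem scrG_mul0 {G0 G1 G2 : A} (m s : ℕ) (hs : s ≤ 2 * m) :
    G0 * scrG G0 G1 G2 m s = scrG G0 G1 G2 (m + 1) s := by
  unfold scrG
  have e : m + 1 - (s + 1) / 2 = (m - (s + 1) / 2) + 1 := by omega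
  rw [e]; ring

theorem scrG_mul1 {G0 G1 G2 : A} (h : G1 ^ 2 = G0 * G2) (m s : ℕ) (hs : s ≤ 2 * m) :
    G1 * scrG G0 G1 G2 m s = scrG G0 G1 G2 (m + 1) (s + 1) := by
  unfold scrG
  obtain ⟨k, rfl | rfl⟩ := Nat.even_or_odd' s
  · have e1 : m + 1 - (2 * k + 1 + 1) / 2 = m - k := by omega
    have e2 : (2 * k + 1) % 2 = 1 := by omega
    have e3 : (2 * k + 1) / 2 = k := by omega
    have e5 : (2 * k) % 2 = 0 := by omega
    have e6 : (2 * k) / 2 = k := by omega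
    rw [e1, e2, e3, e5, e6]; ring
  · obtain ⟨d, rfl⟩ : ∃ d, m = k + 1 + d := ⟨m - (k + 1), by omega⟩
    have e1 : k + 1 + d + 1 - (2 * k + 1 + 1 + 1) / 2 = d + 1 := by omega
    have e2 : (2 * k + 1 + 1) % 2 = 0 := by omega
    have e3 : (2 * k + 1 + 1) / 2 = k + 1 := by omega
    have e4 : k + 1 + d - (k + 1) = d := by omega
    have e5 : (2 * k + 1) % 2 = 1 := by omega
    have e6 : (2 * k + 1) / 2 = k := by omega
    rw [e1, e2, e3, e4, e5, e6]
    linear_combination G0 ^ d * G2 ^ k * h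

theorem scrG_mul2 {G0 G1 G2 : A} (m s : ℕ) :
    G2 * scrG G0 G1 G2 m s = scrG G0 G1 G2 (m + 1) (s + 2) := by
  unfold scrG
  have e : m + 1 - (s + 2 + 1) / 2 = (m - (s + 1) / 2) := by omega
  have e2 : (s + 2) % 2 = s % 2 := by omega
  have e3 : (s + 2) / 2 = s / 2 + 1 := by omega
  rw [e, e2, e3]; ring

theorem scrE_mul1 (X0 X1 : A) (a : ℕ) (Y : ℕ → A) (s : ℕ) :
    X1 * scrE X0 X1 a Y s = scrE X0 X1 (a + 1) Y (s + 1) := by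
  unfold scrE
  have e1 : min (s + 1) (a + 1) = min s a + 1 := by omega
  have e2 : a + 1 - (s + 1) = a - s := by omega
  have e3 : s + 1 - (a + 1) = s - a := by omega
  rw [e1, e2, e3]; ring

theorem scrE_mul0 {X0 X1 : A} {n : ℕ} {Y : ℕ → A}
    (hY : ∀ s, s + 1 ≤ n → X0 * Y (s + 1) = X1 * Y s) (a s : ℕ) (hs : s ≤ a + n) :
    X0 * scrE X0 X1 a Y s = scrE X0 X1 (a + 1) Y s := by
  unfold scrE
  by_cases h : s ≤ a
  · have e1 : min s (a + 1) = min s a := by omega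
    have e2 : a + 1 - s = a - s + 1 := by omega
    have e3 : s - (a + 1) = s - a := by omega
    rw [e1, e2, e3]; ring
  · obtain ⟨d, rfl⟩ : ∃ d, s = a + (d + 1) := ⟨s - a - 1, by omega⟩
    have e1 : min (a + (d + 1)) (a + 1) = a + 1 := by omega
    have e1' : min (a + (d + 1)) a = a := by omega
    have e2 : a + 1 - (a + (d + 1)) = 0 := by omega
    have e2' : a - (a + (d + 1)) = 0 := by omega
    have e3 : a + (d + 1) - (a + 1) = d := by omega
    have e3' : a + (d + 1) - a = d + 1 := by omega
    rw [e1, e2, e3, e1', e2', e3']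
    linear_combination X1 ^ a * hY d (by omega)

theorem scrE_inner0 {X0 X1 c0 : A} {n : ℕ} {Y Y' : ℕ → A}
    (h0 : ∀ s, s ≤ n → c0 * Y s = Y' s) (a s : ℕ) (hs : s ≤ a + n) :
    c0 * scrE X0 X1 a Y s = scrE X0 X1 a Y' s := by
  unfold scrE
  rw [← h0 (s - a) (by omega)]; ring

theorem scrE_inner1 {X0 X1 c0 c1 : A} {n : ℕ} {Y Y' : ℕ → A}
    (h : X0 * c1 = X1 * c0)
    (h0 : ∀ s, s ≤ n → c0 * Y s = Y' s)
    (h1 : ∀ s, s ≤ n → c1 * Y s = Y' (s + 1)) (a s : ℕ) (hs : s ≤ a + n) :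
    c1 * scrE X0 X1 a Y s = scrE X0 X1 a Y' (s + 1) := by
  unfold scrE
  by_cases hh : a ≤ s
  · have e1 : min (s + 1) a = min s a := by omega
    have e2 : a - (s + 1) = a - s := by omega
    have e3 : s + 1 - a = s - a + 1 := by omega
    rw [e1, e2, e3, ← h1 (s - a) (by omega)]; ring
  · obtain ⟨d, rfl⟩ : ∃ d, a = s + (d + 1) := ⟨a - s - 1, by omega⟩
    have e1 : min (s + 1) (s + (d + 1)) = s + 1 := by omega
    have e1' : min s (s + (d + 1)) = s := by omega
    have e2 : s + (d + 1) - (s + 1) = d := by omega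
    have e2' : s + (d + 1) - s = d + 1 := by omega
    have e3 : s + 1 - (s + (d + 1)) = 0 := by omega
    have e3' : s - (s + (d + 1)) = 0 := by omega
    rw [e1, e2, e3, e1', e2', e3', ← h0 0 (by omega)]
    linear_combination X1 ^ s * X0 ^ d * Y 0 * h

theorem scrE_inner2 {X0 X1 c0 c1 c2 : A} {n : ℕ} {Y Y' : ℕ → A}
    (h : X0 * c1 = X1 * c0) (h' : X0 * c2 = X1 * c1)
    (h0 : ∀ s, s ≤ n → c0 * Y s = Y' s)
    (h1 : ∀ s, s ≤ n → c1 * Y s = Y' (s + 1))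
    (h2 : ∀ s, s ≤ n → c2 * Y s = Y' (s + 2)) (a s : ℕ) (hs : s ≤ a + n) :
    c2 * scrE X0 X1 a Y s = scrE X0 X1 a Y' (s + 2) := by
  by_cases hh : a ≤ s
  · unfold scrE
    have e1 : min (s + 2) a = min s a := by omega
    have e2 : a - (s + 2) = a - s := by omega
    have e3 : s + 2 - a = s - a + 2 := by omega
    rw [e1, e2, e3, ← h2 (s - a) (by omega)]; ring
  · obtain ⟨d, rfl⟩ : ∃ d, a = s + d + 1 := ⟨a - s - 1, by omega⟩
    rw [← scrE_mul1 X0 X1 (s + d) Y' (s + 1), ← scrE_inner1 h h0 h1 (s + d) s (by omega)]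
    have e : scrE X0 X1 (s + d + 1) Y s = X0 * scrE X0 X1 (s + d) Y s := by
      unfold scrE
      have e1 : min s (s + d + 1) = min s (s + d) := by omega
      have e2 : s + d + 1 - s = s + d - s + 1 := by omega
      have e3 : s - (s + d + 1) = s - (s + d) := by omega
      rw [e1, e2, e3]; ring
    rw [e]
    linear_combination scrE X0 X1 (s + d) Y s * h'

/-- canonical scroll monomial -/
def scrN (H0 H1 W0 W1 G0 G1 G2 : A) (a b m s : ℕ) : A :=
  scrE H0 H1 a (scrE W0 W1 b (scrG G0 G1 G2 m)) s

variable {H0 H1 W0 W1 G0 G1 G2 : A}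

theorem scrE_swap {X0 X1 c0 c1 : A} {n : ℕ} {Y : ℕ → A} (h : X0 * c1 = X1 * c0)
    (hY : ∀ s, s + 1 ≤ n → X0 * Y (s + 1) = X1 * Y s) (b s : ℕ) (hs : s + 1 ≤ b + n) :
    X0 * scrE c0 c1 b Y (s + 1) = X1 * scrE c0 c1 b Y s := by
  unfold scrE
  by_cases hh : b ≤ s
  · have e1 : min (s + 1) b = min s b := by omega
    have e2 : b - (s + 1) = b - s := by omega
    have e3 : s + 1 - b = s - b + 1 := by omega
    rw [e1, e2, e3]
    linear_combination c1 ^ (min s b) * c0 ^ (b - s) * hY (s - b) (by omega)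
  · obtain ⟨d, rfl⟩ : ∃ d, b = s + (d + 1) := ⟨b - s - 1, by omega⟩
    have e1 : min (s + 1) (s + (d + 1)) = s + 1 := by omega
    have e1' : min s (s + (d + 1)) = s := by omega
    have e2 : s + (d + 1) - (s + 1) = d := by omega
    have e2' : s + (d + 1) - s = d + 1 := by omega
    have e3 : s + 1 - (s + (d + 1)) = 0 := by omega
    have e3' : s - (s + (d + 1)) = 0 := by omega
    rw [e1, e2, e3, e1', e2', e3']
    linear_combination c1 ^ s * c0 ^ d * Y 0 * h

/-- the quadratic relations of the scroll S(1,1,2) -/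
structure Scroll (H0 H1 W0 W1 G0 G1 G2 : A) : Prop where
  hw : H0 * W1 = H1 * W0
  hg : H0 * G1 = H1 * G0
  hg' : H0 * G2 = H1 * G1
  wg : W0 * G1 = W1 * G0
  wg' : W0 * G2 = W1 * G1
  gg : G1 ^ 2 = G0 * G2


theorem scrN_H0 (hS : Scroll H0 H1 W0 W1 G0 G1 G2) (a b m s : ℕ) (hs : s ≤ a + b + 2 * m) :
    H0 * scrN H0 H1 W0 W1 G0 G1 G2 a b m s = scrN H0 H1 W0 W1 G0 G1 G2 (a + 1) b m s :=
  scrE_mul0 (n := b + 2 * m)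
    (fun s hs => scrE_swap (n := 2 * m) hS.hw (scrG_swap hS.hg hS.hg' m) b s hs) a s (by omega)

theorem scrN_H1 (a b m s : ℕ) :
    H1 * scrN H0 H1 W0 W1 G0 G1 G2 a b m s = scrN H0 H1 W0 W1 G0 G1 G2 (a + 1) b m (s + 1) :=
  scrE_mul1 _ _ _ _ _

theorem scrN_W0 (hS : Scroll H0 H1 W0 W1 G0 G1 G2) (a b m s : ℕ) (hs : s ≤ a + b + 2 * m) :
    W0 * scrN H0 H1 W0 W1 G0 G1 G2 a b m s = scrN H0 H1 W0 W1 G0 G1 G2 a (b + 1) m s :=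
  scrE_inner0 (n := b + 2 * m)
    (fun s hs => scrE_mul0 (n := 2 * m) (scrG_swap hS.wg hS.wg' m) b s hs) a s (by omega)

theorem scrN_W1 (hS : Scroll H0 H1 W0 W1 G0 G1 G2) (a b m s : ℕ) (hs : s ≤ a + b + 2 * m) :
    W1 * scrN H0 H1 W0 W1 G0 G1 G2 a b m s = scrN H0 H1 W0 W1 G0 G1 G2 a (b + 1) m (s + 1) :=
  scrE_inner1 (n := b + 2 * m) hS.hw
    (fun s hs => scrE_mul0 (n := 2 * m) (scrG_swap hS.wg hS.wg' m) b s hs)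
    (fun s _ => scrE_mul1 _ _ _ _ _) a s (by omega)

theorem scrN_G0 (hS : Scroll H0 H1 W0 W1 G0 G1 G2) (a b m s : ℕ) (hs : s ≤ a + b + 2 * m) :
    G0 * scrN H0 H1 W0 W1 G0 G1 G2 a b m s = scrN H0 H1 W0 W1 G0 G1 G2 a b (m + 1) s :=
  scrE_inner0 (n := b + 2 * m)
    (fun s hs => scrE_inner0 (n := 2 * m) (scrG_mul0 m) b s hs) a s (by omega)

theorem scrN_G1 (hS : Scroll H0 H1 W0 W1 G0 G1 G2) (a b m s : ℕ) (hs : s ≤ a + b + 2 * m) :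
    G1 * scrN H0 H1 W0 W1 G0 G1 G2 a b m s = scrN H0 H1 W0 W1 G0 G1 G2 a b (m + 1) (s + 1) :=
  scrE_inner1 (n := b + 2 * m) hS.hg
    (fun s hs => scrE_inner0 (n := 2 * m) (scrG_mul0 m) b s hs)
    (fun s hs => scrE_inner1 (n := 2 * m) hS.wg (scrG_mul0 m) (scrG_mul1 hS.gg m) b s hs)
    a s (by omega)

theorem scrN_G2 (hS : Scroll H0 H1 W0 W1 G0 G1 G2) (a b m s : ℕ) (hs : s ≤ a + b + 2 * m) :
    G2 * scrN H0 H1 W0 W1 G0 G1 G2 a b m s = scrN H0 H1 W0 W1 G0 G1 G2 a b (m + 1) (s + 2) :=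
  scrE_inner2 (n := b + 2 * m) hS.hg hS.hg'
    (fun s hs => scrE_inner0 (n := 2 * m) (scrG_mul0 m) b s hs)
    (fun s hs => scrE_inner1 (n := 2 * m) hS.wg (scrG_mul0 m) (scrG_mul1 hS.gg m) b s hs)
    (fun s hs => scrE_inner2 (n := 2 * m) hS.wg hS.wg' (scrG_mul0 m) (scrG_mul1 hS.gg m)
      (fun s _ => scrG_mul2 m s) b s hs)
    a s (by omega)

end scroll

set_option linter.unusedSimpArgs false

/-! ### The toric-type parametrization modulo `z₁` -/

/-- reduction modulo `z₁`: variables `H, W, G, y` are `X 0, X 1, X 2, X 3` -/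
def th : MvPolynomial (Fin 8) ℂ →ₐ[ℂ] MvPolynomial (Fin 4) ℂ :=
  aeval ![0, X 3 * X 0, X 1, X 3 * X 1, X 0, X 2, X 3 ^ 2 * X 2, C (-2) * (X 3 * X 2)]

theorem th_X1 : th (X 1) = X 3 * X 0 := by
  rw [th, aeval_X]; rfl

theorem th_X2 : th (X 2) = X 1 := by
  rw [th, aeval_X]; rfl

theorem th_X3 : th (X 3) = X 3 * X 1 := by
  rw [th, aeval_X]; rfl

theorem th_X4 : th (X 4) = X 0 := by
  rw [th, aeval_X]; rfl

theorem th_X5 : th (X 5) = X 2 := by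
  rw [th, aeval_X]; rfl

theorem th_X6 : th (X 6) = X 3 ^ 2 * X 2 := by
  rw [th, aeval_X]; rfl

theorem th_X7 : th (X 7) = C (-2) * (X 3 * X 2) := by
  rw [th, aeval_X]; rfl

/-- the remaining cubic relation -/
def rr : MvPolynomial (Fin 4) ℂ := X 0 ^ 3 - X 3 * X 1 ^ 3 + C (12 * q) * (X 3 * X 2 ^ 2)

/-- exponents of monomials in the image of `th` -/
def MM : Set (Fin 4 →₀ ℕ) := {e | e 3 ≤ e 0 + e 1 + 2 * e 2}

/-- the span of those monomials -/
def SM : Submodule ℂ (MvPolynomial (Fin 4) ℂ) :=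
  Submodule.span ℂ ((fun e => monomial e (1 : ℂ)) '' MM)

section sigma

variable {A : Type*} [CommRing A] [Algebra ℂ A]

/-- linear section sending a monomial to the canonical scroll monomial -/
def sig (N : ℕ → ℕ → ℕ → ℕ → A) : MvPolynomial (Fin 4) ℂ →ₗ[ℂ] A :=
  (basisMonomials (Fin 4) ℂ).constr ℂ (fun e => N (e 0) (e 1) (e 2) (e 3))

theorem sig_monomial (N : ℕ → ℕ → ℕ → ℕ → A) (e : Fin 4 →₀ ℕ) (c : ℂ) :
    sig N (monomial e c) = c • N (e 0) (e 1) (e 2) (e 3) := by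
  have h : monomial e c = c • (basisMonomials (Fin 4) ℂ) e := by
    simp [coe_basisMonomials, smul_monomial]
  rw [h, map_smul, sig, Module.Basis.constr_basis]

theorem step_aux (N : ℕ → ℕ → ℕ → ℕ → A) (δ : Fin 4 →₀ ℕ) (c : ℂ)
    (t : MvPolynomial (Fin 4) ℂ) (v : A) (ht : t = monomial δ c)
    (hM : ∀ e ∈ MM, e + δ ∈ MM)
    (hN : ∀ e ∈ MM, c • N ((e + δ) 0) ((e + δ) 1) ((e + δ) 2) ((e + δ) 3)
      = N (e 0) (e 1) (e 2) (e 3) * v)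
    (F : MvPolynomial (Fin 4) ℂ) (hF : F ∈ SM) :
    F * t ∈ SM ∧ sig N (F * t) = sig N F * v := by
  subst ht
  induction hF using Submodule.span_induction with
  | mem x hx =>
    obtain ⟨e, he, rfl⟩ := hx
    simp only [monomial_mul, one_mul]
    refine ⟨?_, ?_⟩
    · have : monomial (e + δ) c = c • monomial (e + δ) (1 : ℂ) := by simp [smul_monomial]
      rw [this]
      exact Submodule.smul_mem _ _ (Submodule.subset_span ⟨_, hM e he, rfl⟩)
    · rw [sig_monomial, sig_monomial, hN e he, one_smul]
  | zero => simp
  | add x y _ _ hx hy =>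
    rw [add_mul, map_add, map_add, hx.2, hy.2, add_mul]
    exact ⟨Submodule.add_mem _ hx.1 hy.1, rfl⟩
  | smul a x _ hx =>
    rw [smul_mul_assoc, map_smul, map_smul, hx.2, smul_mul_assoc]
    exact ⟨Submodule.smul_mem _ _ hx.1, rfl⟩

theorem step (ev : MvPolynomial (Fin 8) ℂ →ₐ[ℂ] A) (v : A) (h0 : ev (X 0) = 0)
    (h7 : ev (X 7) = (-2 : ℂ) • v)
    (hS : Scroll (ev (X 4)) (ev (X 1)) (ev (X 2)) (ev (X 3)) (ev (X 5)) v (ev (X 6)))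
    (F : MvPolynomial (Fin 4) ℂ) (hF : F ∈ SM) (i : Fin 8) :
    F * th (X i) ∈ SM ∧
    sig (scrN (ev (X 4)) (ev (X 1)) (ev (X 2)) (ev (X 3)) (ev (X 5)) v (ev (X 6))) (F * th (X i))
      = sig (scrN (ev (X 4)) (ev (X 1)) (ev (X 2)) (ev (X 3)) (ev (X 5)) v (ev (X 6))) F
        * ev (X i) := by
  fin_cases i
  · simp [th, h0]
  · apply step_aux _ (Finsupp.single 0 1 + Finsupp.single 3 1) 1 _ _ _ _ _ _ hF
    · refine th_X1.trans ?_
      simp [X, monomial_mul, monomial_pow, C_mul_monomial, add_comm, -map_neg, -C_neg]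
    · intro e he
      simp [MM, Finsupp.single_apply] at he ⊢
      omega
    · intro e he
      simp [Finsupp.single_apply]
      rw [mul_comm, scrN_H1]
  · apply step_aux _ (Finsupp.single 1 1) 1 _ _ _ _ _ _ hF
    · refine th_X2.trans ?_
      simp [X, monomial_mul, monomial_pow, C_mul_monomial, add_comm, -map_neg, -C_neg]
    · intro e he
      simp [MM, Finsupp.single_apply] at he ⊢
      omega
    · intro e he
      simp [Finsupp.single_apply]
      rw [mul_comm, scrN_W0 hS _ _ _ _ he]
  · apply step_aux _ (Finsupp.single 1 1 + Finsupp.single 3 1) 1 _ _ _ _ _ _ hF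
    · refine th_X3.trans ?_
      simp [X, monomial_mul, monomial_pow, C_mul_monomial, add_comm, -map_neg, -C_neg]
    · intro e he
      simp [MM, Finsupp.single_apply] at he ⊢
      omega
    · intro e he
      simp [Finsupp.single_apply]
      rw [mul_comm, scrN_W1 hS _ _ _ _ he]
  · apply step_aux _ (Finsupp.single 0 1) 1 _ _ _ _ _ _ hF
    · refine th_X4.trans ?_
      simp [X, monomial_mul, monomial_pow, C_mul_monomial, add_comm, -map_neg, -C_neg]
    · intro e he
      simp [MM, Finsupp.single_apply] at he ⊢
      omega
    · intro e he
      simp [Finsupp.single_apply]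
      rw [mul_comm, scrN_H0 hS _ _ _ _ he]
  · apply step_aux _ (Finsupp.single 2 1) 1 _ _ _ _ _ _ hF
    · refine th_X5.trans ?_
      simp [X, monomial_mul, monomial_pow, C_mul_monomial, add_comm, -map_neg, -C_neg]
    · intro e he
      simp [MM, Finsupp.single_apply] at he ⊢
      omega
    · intro e he
      simp [Finsupp.single_apply]
      rw [mul_comm, scrN_G0 hS _ _ _ _ he]
  · apply step_aux _ (Finsupp.single 2 1 + Finsupp.single 3 2) 1 _ _ _ _ _ _ hF
    · refine th_X6.trans ?_
      simp [X, monomial_mul, monomial_pow, C_mul_monomial, add_comm, -map_neg, -C_neg]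
    · intro e he
      simp [MM, Finsupp.single_apply] at he ⊢
      omega
    · intro e he
      simp [Finsupp.single_apply]
      rw [mul_comm, scrN_G2 hS _ _ _ _ he]
  · apply step_aux _ (Finsupp.single 2 1 + Finsupp.single 3 1) (-2) _ _ _ _ _ _ hF
    · refine th_X7.trans ?_
      simp [X, monomial_mul, monomial_pow, C_mul_monomial, add_comm, -map_neg, -C_neg]
    · intro e he
      simp [MM, Finsupp.single_apply] at he ⊢
      omega
    · intro e he
      show _ = _ * ev (X 7)
      rw [h7]
      simp [Finsupp.single_apply]
      rw [mul_comm, scrN_G1 hS _ _ _ _ he]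

theorem step_all (ev : MvPolynomial (Fin 8) ℂ →ₐ[ℂ] A) (v : A) (h0 : ev (X 0) = 0)
    (h7 : ev (X 7) = (-2 : ℂ) • v)
    (hS : Scroll (ev (X 4)) (ev (X 1)) (ev (X 2)) (ev (X 3)) (ev (X 5)) v (ev (X 6)))
    (f : MvPolynomial (Fin 8) ℂ)
    (F : MvPolynomial (Fin 4) ℂ) (hF : F ∈ SM) :
    F * th f ∈ SM ∧
    sig (scrN (ev (X 4)) (ev (X 1)) (ev (X 2)) (ev (X 3)) (ev (X 5)) v (ev (X 6))) (F * th f)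
      = sig (scrN (ev (X 4)) (ev (X 1)) (ev (X 2)) (ev (X 3)) (ev (X 5)) v (ev (X 6))) F
        * ev f := by
  induction f using MvPolynomial.induction_on with
  | C a =>
    have e1 : F * th (C a) = a • F := by
      rw [← algebraMap_eq, AlgHom.commutes, algebraMap_eq, mul_comm, C_mul']
    rw [e1, map_smul, ← algebraMap_eq, AlgHom.commutes, ← Algebra.commutes, ← Algebra.smul_def]
    exact ⟨Submodule.smul_mem _ _ hF, rfl⟩
  | add f g hf hg =>
    rw [map_add, mul_add, map_add, map_add, hf.2, hg.2, mul_add]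
    exact ⟨Submodule.add_mem _ hf.1 hg.1, rfl⟩
  | mul_X f i hf =>
    have := step ev v h0 h7 hS _ hf.1 i
    rw [map_mul th, ← mul_assoc, map_mul ev, ← mul_assoc, ← hf.2]
    exact this

theorem one_mem_SM : (1 : MvPolynomial (Fin 4) ℂ) ∈ SM :=
  Submodule.subset_span ⟨0, by simp [MM], rfl⟩

theorem SM_coeff (F : MvPolynomial (Fin 4) ℂ) (hF : F ∈ SM) (e : Fin 4 →₀ ℕ)
    (he : coeff e F ≠ 0) : e ∈ MM := by
  by_contra hne
  apply he
  clear he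
  induction hF using Submodule.span_induction with
  | mem x hx =>
    obtain ⟨e', he', rfl⟩ := hx
    simp only [coeff_monomial]
    rw [if_neg]
    rintro rfl
    exact hne he'
  | zero => simp
  | add x y _ _ hx hy => simp [hx, hy]
  | smul a x _ hx => simp [hx]

/-- a multiple of `rr` in `SM` has a cofactor of bounded excess -/
theorem cofactor_bound (u : MvPolynomial (Fin 4) ℂ) (h : rr * u ∈ SM) (e : Fin 4 →₀ ℕ)
    (he : e ∈ u.support) : e 3 ≤ e 0 + e 1 + 2 * e 2 + 2 := by
  let κ : (Fin 4 →₀ ℕ) → ℤ := fun e => (e 3 : ℤ) - e 0 - e 1 - 2 * e 2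
  obtain ⟨m, hm, hmax⟩ := Finset.exists_max_image u.support κ ⟨e, he⟩
  have hz : ∀ d, κ m < κ d → coeff d u = 0 := by
    intro d hd
    by_contra hc
    exact absurd (hmax d (by simpa [mem_support_iff] using hc)) (not_le.mpr hd)
  let δ : Fin 4 →₀ ℕ := Finsupp.single 1 3 + Finsupp.single 3 1
  have hrr : rr * u = u * monomial (Finsupp.single 0 3) 1
      - u * monomial δ 1
      + u * monomial (Finsupp.single 2 2 + Finsupp.single 3 1) (12 * q) := by
    have a1 : (X 0 : MvPolynomial (Fin 4) ℂ) ^ 3 = monomial (Finsupp.single 0 3) 1 := by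
      simp [X, monomial_pow]
    have a2 : (X 3 : MvPolynomial (Fin 4) ℂ) * X 1 ^ 3 = monomial δ 1 := by
      simp [X, monomial_pow, monomial_mul, δ, add_comm]
    have a3 : C (12 * q) * ((X 3 : MvPolynomial (Fin 4) ℂ) * X 2 ^ 2) =
        monomial (Finsupp.single 2 2 + Finsupp.single 3 1) (12 * q) := by
      simp [X, monomial_pow, monomial_mul, C_mul_monomial, add_comm, -map_mul, -C_mul]
    rw [rr, a1, a2, a3]; ring
  have hc : coeff (m + δ) (rr * u) = - coeff m u := by
    rw [hrr, coeff_add, coeff_sub, coeff_mul_monomial', coeff_mul_monomial, coeff_mul_monomial']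
    have t1 : (if (Finsupp.single 0 3 : Fin 4 →₀ ℕ) ≤ m + δ then
        coeff (m + δ - Finsupp.single 0 3) u * 1 else 0) = 0 := by
      split_ifs with hle
      · rw [hz, zero_mul]
        have := hle 0
        simp [κ, δ, Finsupp.single_apply] at this ⊢
        omega
      · rfl
    have t2 : (if (Finsupp.single 2 2 + Finsupp.single 3 1: Fin 4 →₀ ℕ) ≤ m + δ then
        coeff (m + δ - (Finsupp.single 2 2 + Finsupp.single 3 1)) u * (12 * q) else 0) = 0 := by
      split_ifs with hle
      · rw [hz, zero_mul]
        have := hle 2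
        simp [κ, δ, Finsupp.single_apply] at this ⊢
        omega
      · rfl
    rw [t1, t2]; ring
  have hmem := SM_coeff _ h (m + δ) (by rw [hc]; simpa [mem_support_iff] using hm)
  have h2 := hmax e he
  simp [MM, δ, Finsupp.single_apply] at hmem
  simp only [κ] at h2
  omega

theorem ev_zero (ev : MvPolynomial (Fin 8) ℂ →ₐ[ℂ] A) (v : A) (h0 : ev (X 0) = 0)
    (h7 : ev (X 7) = (-2 : ℂ) • v)
    (hS : Scroll (ev (X 4)) (ev (X 1)) (ev (X 2)) (ev (X 3)) (ev (X 5)) v (ev (X 6)))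
    (R : Fin 3 → MvPolynomial (Fin 8) ℂ) (hR : ∀ k, ev (R k) = 0)
    (hR' : ∀ k, th (R k) = rr * X 3 ^ (k : ℕ))
    (f : MvPolynomial (Fin 8) ℂ) (u : MvPolynomial (Fin 4) ℂ) (hf : th f = rr * u) :
    ev f = 0 := by
  have h1 := step_all ev v h0 h7 hS f 1 one_mem_SM
  have hN1 : sig (scrN (ev (X 4)) (ev (X 1)) (ev (X 2)) (ev (X 3)) (ev (X 5)) v (ev (X 6))) 1
      = 1 := by
    have : (1 : MvPolynomial (Fin 4) ℂ) = monomial 0 1 := rfl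
    rw [this, sig_monomial]
    simp [scrN, scrE, scrG]
  rw [one_mul, hN1, one_mul, hf] at h1
  rw [← h1.2]
  conv_lhs => rw [u.as_sum]
  rw [Finset.mul_sum, map_sum]
  apply Finset.sum_eq_zero
  intro e he
  have hb := cofactor_bound u h1.1 e he
  obtain ⟨k, e', he', rfl⟩ : ∃ k : Fin 3, ∃ e' ∈ MM, e = e' + Finsupp.single 3 (k : ℕ) := by
    have key : ∃ k : Fin 3, (k : ℕ) ≤ e 3 ∧ e 3 - k ≤ e 0 + e 1 + 2 * e 2 := by
      by_cases c0 : e 3 = 0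
      · exact ⟨0, by simp, by simp [c0]⟩
      by_cases c1 : e 3 = 1
      · exact ⟨1, by simp [c1], by simp [c1]⟩
      · exact ⟨2, by simp; omega, by simp; omega⟩
    obtain ⟨k, hk1, hk2⟩ := key
    refine ⟨k, e - Finsupp.single 3 (k : ℕ), ?_, ?_⟩
    · simp [MM, Finsupp.single_apply] at hk2 ⊢
      omega
    · ext i
      by_cases hi : i = 3
      · subst hi; simp; omega
      · simp [Finsupp.single_apply, Ne.symm hi]
  have e1 : rr * monomial (e' + Finsupp.single 3 (k : ℕ))
      (coeff (e' + Finsupp.single 3 (k : ℕ)) u)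
      = monomial e' (coeff (e' + Finsupp.single 3 (k : ℕ)) u) * th (R k) := by
    rw [hR', X_pow_eq_monomial, mul_left_comm, monomial_mul, mul_one]
  have hmem : monomial e' (coeff (e' + Finsupp.single 3 (k : ℕ)) u) ∈ SM := by
    have : monomial e' (coeff (e' + Finsupp.single 3 (k : ℕ)) u)
        = (coeff (e' + Finsupp.single 3 (k : ℕ)) u) • monomial e' (1 : ℂ) := by
      simp [smul_monomial]
    rw [this]
    exact Submodule.smul_mem _ _ (Submodule.subset_span ⟨_, he', rfl⟩)
  rw [e1, (step_all ev v h0 h7 hS (R k) _ hmem).2, hR, mul_zero]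

end sigma

/-! ### Points -/

theorem omega_rel : ω ^ 2 + ω + 1 = 0 := by
  have h : IsPrimitiveRoot ω 3 := by
    have := Complex.isPrimitiveRoot_exp 3 (by norm_num)
    simpa [ω] using this
  have h1 : ω ≠ 1 := h.ne_one (by norm_num)
  have h3 : ω ^ 3 = 1 := h.pow_eq_one
  have : (ω - 1) * (ω ^ 2 + ω + 1) = 0 := by linear_combination h3
  rcases mul_eq_zero.mp this with h | h
  · exact absurd (sub_eq_zero.mp h) h1
  · exact h

theorem q_ne : q ≠ 0 := by
  intro h
  have := q_sq
  rw [h] at this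
  norm_num at this

/-- every pair of values of the two basic invariants of `G₄` is attained -/
theorem surj_pts (W G : ℂ) :
    ∃ a b : ℂ, a ^ 4 + 2 * q * a ^ 2 * b ^ 2 + b ^ 4 = W ∧ a ^ 5 * b - a * b ^ 5 = G := by
  obtain ⟨m, hm⟩ : ∃ m : ℂ, m * ((W - 2 * q * m) ^ 2 - 4 * m ^ 2) = G ^ 2 := by
    let P : Polynomial ℂ := Polynomial.C (-16) * Polynomial.X ^ 3
      + Polynomial.C (-4 * q * W) * Polynomial.X ^ 2
      + Polynomial.C (W ^ 2) * Polynomial.X + Polynomial.C (- G ^ 2)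
    have hP : P.degree = 3 := Polynomial.degree_cubic (by norm_num)
    obtain ⟨m, hm⟩ := IsAlgClosed.exists_root P (by rw [hP]; norm_num)
    refine ⟨m, ?_⟩
    simp [P, Polynomial.IsRoot] at hm
    linear_combination hm + 4 * m ^ 3 * q_sq
  obtain ⟨σ, hσ⟩ : ∃ s : ℂ, (W - 2 * q * m + 2 * m) = s ^ 2 :=
    (IsAlgClosed.exists_pow_nat_eq (W - 2 * q * m + 2 * m) (n := 2) (by norm_num)).imp fun _ h => h.symm
  obtain ⟨d, hd⟩ : ∃ s : ℂ, (σ ^ 2 - 4 * m) = s ^ 2 :=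
    (IsAlgClosed.exists_pow_nat_eq (σ ^ 2 - 4 * m) (n := 2) (by norm_num)).imp fun _ h => h.symm
  obtain ⟨a, ha⟩ : ∃ s : ℂ, ((σ + d) / 2) = s ^ 2 :=
    (IsAlgClosed.exists_pow_nat_eq ((σ + d) / 2) (n := 2) (by norm_num)).imp fun _ h => h.symm
  obtain ⟨b, hb⟩ : ∃ s : ℂ, ((σ - d) / 2) = s ^ 2 :=
    (IsAlgClosed.exists_pow_nat_eq ((σ - d) / 2) (n := 2) (by norm_num)).imp fun _ h => h.symm
  have hab : a ^ 2 * b ^ 2 = m := by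
    rw [← ha, ← hb]; linear_combination (1 / 4) * hd
  have hs : a ^ 4 + b ^ 4 = W - 2 * q * m := by
    have e : a ^ 4 + b ^ 4 = (a ^ 2 + b ^ 2) ^ 2 - 2 * (a ^ 2 * b ^ 2) := by ring
    rw [e, hab, ← ha, ← hb]; linear_combination -hσ
  have hW : a ^ 4 + 2 * q * a ^ 2 * b ^ 2 + b ^ 4 = W := by
    linear_combination hs + 2 * q * hab
  have hG : (a ^ 5 * b - a * b ^ 5) ^ 2 = G ^ 2 := by
    have e : (a ^ 5 * b - a * b ^ 5) ^ 2
      = (a ^ 2 * b ^ 2) * ((a ^ 4 + b ^ 4) ^ 2 - 4 * (a ^ 2 * b ^ 2) ^ 2) := by ring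
    rw [e, hab, hs, hm]
  rcases sq_eq_sq_iff_eq_or_eq_neg.mp hG with h | h
  · exact ⟨a, b, hW, h⟩
  · refine ⟨-a, b, ?_, ?_⟩
    · linear_combination hW
    · linear_combination -h

/-- division by `rr`, which is monic in `X 0` -/
theorem rr_div (F : MvPolynomial (Fin 4) ℂ) :
    ∃ (u : MvPolynomial (Fin 4) ℂ) (A0 A1 A2 : MvPolynomial (Fin 3) ℂ),
      F = rr * u + rename Fin.succ A0 + rename Fin.succ A1 * X 0
        + rename Fin.succ A2 * X 0 ^ 2 := by
  induction F using MvPolynomial.induction_on with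
  | C a => exact ⟨0, C a, 0, 0, by simp⟩
  | add f g hf hg =>
    obtain ⟨u, A0, A1, A2, h⟩ := hf
    obtain ⟨u', A0', A1', A2', h'⟩ := hg
    refine ⟨u + u', A0 + A0', A1 + A1', A2 + A2', ?_⟩
    simp only [map_add]
    rw [h, h']; ring
  | mul_X f i hf =>
    obtain ⟨u, A0, A1, A2, h⟩ := hf
    refine Fin.cases ?_ (fun j => ?_) i
    · refine ⟨u * X 0 + rename Fin.succ A2,
        A2 * (X 2 * X 0 ^ 3 - C (12 * q) * (X 2 * X 1 ^ 2)), A0, A1, ?_⟩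
      have s0 : (Fin.succ 0 : Fin 4) = 1 := rfl
      have s1 : (Fin.succ 1 : Fin 4) = 2 := rfl
      have s2 : (Fin.succ 2 : Fin 4) = 3 := rfl
      simp only [map_mul, map_sub, map_pow, rename_X, s0, s1, s2, rename_C]
      rw [h, rr]
      simp only [map_mul]
      ring
    · refine ⟨u * X j.succ, A0 * X j, A1 * X j, A2 * X j, ?_⟩
      simp only [map_mul, rename_X]
      rw [h]; ring

/-- polynomials vanishing on the parametrized set are multiples of `rr` -/
theorem rr_dvd (F : MvPolynomial (Fin 4) ℂ)
    (hF : ∀ a b t : ℂ, eval ![-t * (a ^ 4 - 2 * q * a ^ 2 * b ^ 2 + b ^ 4),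
      a ^ 4 + 2 * q * a ^ 2 * b ^ 2 + b ^ 4, a ^ 5 * b - a * b ^ 5, -t ^ 3] F = 0) :
    ∃ u, F = rr * u := by
  obtain ⟨u, A0, A1, A2, h⟩ := rr_div F
  -- the three remainders, evaluated
  have key : ∀ a b t : ℂ,
      let P : Fin 3 → ℂ := ![a ^ 4 + 2 * q * a ^ 2 * b ^ 2 + b ^ 4, a ^ 5 * b - a * b ^ 5, -t ^ 3]
      let H : ℂ := -t * (a ^ 4 - 2 * q * a ^ 2 * b ^ 2 + b ^ 4)
      eval P A0 + eval P A1 * H + eval P A2 * H ^ 2 = 0 := by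
    intro a b t P H
    have h1 := hF a b t
    have hv : (![-t * (a ^ 4 - 2 * q * a ^ 2 * b ^ 2 + b ^ 4),
      a ^ 4 + 2 * q * a ^ 2 * b ^ 2 + b ^ 4, a ^ 5 * b - a * b ^ 5, -t ^ 3] : Fin 4 → ℂ)
      = Matrix.vecCons H P := rfl
    have hc : (Matrix.vecCons H P) ∘ Fin.succ = P := by ext i; simp
    rw [hv, h] at h1
    have hr : eval (Matrix.vecCons H P) rr = 0 := by
      have v0 : Matrix.vecCons H P 0 = H := rfl
      have v1 : Matrix.vecCons H P 1 = a ^ 4 + 2 * q * a ^ 2 * b ^ 2 + b ^ 4 := rfl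
      have v2 : Matrix.vecCons H P 2 = a ^ 5 * b - a * b ^ 5 := rfl
      have v3 : Matrix.vecCons H P 3 = -t ^ 3 := rfl
      rw [rr]
      simp only [map_add, map_sub, map_mul, map_pow, eval_X, eval_C, v0, v1, v2, v3, H]
      linear_combination (16 * q * t ^ 3 * a ^ 6 * b ^ 6) * q_sq
    simp only [map_add, map_mul, map_pow, eval_X, eval_rename, hc, hr] at h1
    simp at h1
    exact h1
  have key2 : ∀ a b t : ℂ,
      let P : Fin 3 → ℂ := ![a ^ 4 + 2 * q * a ^ 2 * b ^ 2 + b ^ 4, a ^ 5 * b - a * b ^ 5, -t ^ 3]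
      let H : ℂ := -t * (a ^ 4 - 2 * q * a ^ 2 * b ^ 2 + b ^ 4)
      eval P A0 = 0 ∧ eval P A1 * H = 0 ∧ eval P A2 * H ^ 2 = 0 := by
    intro a b t P H
    have w3 : ω ^ 3 = 1 := by linear_combination (ω - 1) * omega_rel
    have k0 := key a b t
    have k1 := key a b (ω * t)
    have k2 := key a b (ω ^ 2 * t)
    have t1 : -(ω * t) ^ 3 = -t ^ 3 := by rw [mul_pow, w3, one_mul]
    have t2 : -(ω ^ 2 * t) ^ 3 = -t ^ 3 := by
      have : ω ^ 6 = 1 := by linear_combination (ω ^ 3 + 1) * w3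
      rw [mul_pow, ← pow_mul, this, one_mul]
    have H1 : -(ω * t) * (a ^ 4 - 2 * q * a ^ 2 * b ^ 2 + b ^ 4) = ω * H := by simp only [H]; ring
    have H2 : -(ω ^ 2 * t) * (a ^ 4 - 2 * q * a ^ 2 * b ^ 2 + b ^ 4) = ω ^ 2 * H := by
      simp only [H]; ring
    simp only [t1, H1] at k1
    simp only [t2, H2] at k2
    have k0' : eval P A0 + eval P A1 * H + eval P A2 * H ^ 2 = 0 := k0
    have k1' : eval P A0 + eval P A1 * (ω * H) + eval P A2 * (ω * H) ^ 2 = 0 := k1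
    have k2' : eval P A0 + eval P A1 * (ω ^ 2 * H) + eval P A2 * (ω ^ 2 * H) ^ 2 = 0 := k2
    generalize eval P A0 = E0 at *
    generalize eval P A1 = E1 at *
    generalize eval P A2 = E2 at *
    clear k0 k1 k2 t1 t2 H1 H2
    generalize H = H at *
    have w2 : ω ^ 2 = -1 - ω := by linear_combination omega_rel
    have w4 : ω ^ 4 = ω := by linear_combination ω * w3
    refine ⟨?_, ?_, ?_⟩
    · have : 3 * E0 = 0 := by
        linear_combination k0' + k1' + k2' - (E1 * H + E2 * H ^ 2) * omega_rel
          - E2 * H ^ 2 * w4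
      simpa using this
    · have : 3 * (E1 * H) = 0 := by
        linear_combination k0' + ω ^ 2 * k1' + ω * k2' - (E0 + E2 * H ^ 2) * omega_rel
          - 2 * E1 * H * w3 - E2 * H ^ 2 * (1 + ω) * w4
      simpa using this
    · have : 3 * (E2 * H ^ 2) = 0 := by
        linear_combination k0' + ω * k1' + ω ^ 2 * k2' - (E0 + E1 * H) * omega_rel
          - E1 * H * w4 - E2 * H ^ 2 * (w3 + (ω ^ 3 + 1) * w3)
      simpa using this
  -- multiply by a polynomial that vanishes where `H` does
  let D : MvPolynomial (Fin 3) ℂ := X 2 * (X 0 ^ 3 - C (12 * q) * X 1 ^ 2)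
  have hD : D ≠ 0 := by
    intro h0
    have := congrArg (eval ![1, 0, 1]) h0
    simp [D] at this
  have fin : ∀ B : MvPolynomial (Fin 3) ℂ, (∀ a b t : ℂ,
      eval ![a ^ 4 + 2 * q * a ^ 2 * b ^ 2 + b ^ 4, a ^ 5 * b - a * b ^ 5, -t ^ 3] B
        * (-t * (a ^ 4 - 2 * q * a ^ 2 * b ^ 2 + b ^ 4)) ^ 2 = 0) → B = 0 := by
    intro B hB
    have : B * D = 0 := by
      apply MvPolynomial.funext
      intro v
      obtain ⟨a, b, hab, hab'⟩ := surj_pts (v 0) (v 1)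
      obtain ⟨t, ht⟩ := IsAlgClosed.exists_pow_nat_eq (-v 2) (n := 3) (by norm_num)
      have hv : v = ![a ^ 4 + 2 * q * a ^ 2 * b ^ 2 + b ^ 4, a ^ 5 * b - a * b ^ 5, -t ^ 3] := by
        ext i
        fin_cases i
        · exact hab.symm
        · exact hab'.symm
        · simp [ht]
      have h1 := hB a b t
      rw [← hv] at h1
      have hDv : eval v D = (-t * (a ^ 4 - 2 * q * a ^ 2 * b ^ 2 + b ^ 4)) ^ 3 := by
        have e2 : v 2 = -t ^ 3 := by rw [ht]; ring
        simp only [D, map_mul, map_sub, map_pow, eval_X, eval_C]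
        rw [← hab, ← hab', e2]
        linear_combination (-16 * q * t ^ 3 * a ^ 6 * b ^ 6) * q_sq
      rw [map_mul, hDv, map_zero]
      linear_combination (-t * (a ^ 4 - 2 * q * a ^ 2 * b ^ 2 + b ^ 4)) * h1
    rcases mul_eq_zero.mp this with h | h
    · exact h
    · exact absurd h hD
  have z0 : A0 = 0 := fin A0 fun a b t => by rw [(key2 a b t).1, zero_mul]
  have z1 : A1 = 0 := fin A1 fun a b t => by
    have := (key2 a b t).2.1
    linear_combination (-t * (a ^ 4 - 2 * q * a ^ 2 * b ^ 2 + b ^ 4)) * this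
  have z2 : A2 = 0 := fin A2 fun a b t => (key2 a b t).2.2
  refine ⟨u, ?_⟩
  rw [h, z0, z1, z2]
  simp

theorem th_eval (f : MvPolynomial (Fin 8) ℂ) (a b t : ℂ) :
    eval ![-t * (a ^ 4 - 2 * q * a ^ 2 * b ^ 2 + b ^ 4),
      a ^ 4 + 2 * q * a ^ 2 * b ^ 2 + b ^ 4, a ^ 5 * b - a * b ^ 5, -t ^ 3] (th f)
    = eval ![a, b, -t * b, t * a] (φ f) := by
  induction f using MvPolynomial.induction_on with
  | C c => simp [th, φ]
  | add f g hf hg => simp only [map_add, hf, hg]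
  | mul_X f i hf =>
    simp only [map_mul, hf]
    congr 1
    fin_cases i <;> simp [th, φ, z] <;> ring

/-! ### The main theorem -/

theorem Cq_sq {n : ℕ} : (C q : MvPolynomial (Fin n) ℂ) ^ 2 = -3 := by
  rw [← C_pow, q_sq, map_neg]; exact congrArg Neg.neg (map_ofNat C 3)

theorem p_mem_ker (k : Fin 9) : φ (p k) = 0 := by
  have h2 : (C q : MvPolynomial (Fin 4) ℂ) ^ 2 = -3 := Cq_sq
  have h3 : (C q : MvPolynomial (Fin 4) ℂ) ^ 3 = -3 * C q := by linear_combination C q * h2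
  have h4 : (C q : MvPolynomial (Fin 4) ℂ) ^ 4 = 9 := by linear_combination (C q ^ 2 - 3) * h2
  have e0 : φ (X 0) = _ := aeval_X z 0
  have e1 : φ (X 1) = _ := aeval_X z 1
  have e2 : φ (X 2) = _ := aeval_X z 2
  have e3 : φ (X 3) = _ := aeval_X z 3
  have e4 : φ (X 4) = _ := aeval_X z 4
  have e5 : φ (X 5) = _ := aeval_X z 5
  have e6 : φ (X 6) = _ := aeval_X z 6
  have e7 : φ (X 7) = _ := aeval_X z 7
  have eC : ∀ c : ℂ, φ (C c) = C c := fun c => by simp [φ]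
  have n2 : (C 2 : MvPolynomial (Fin 4) ℂ) = 2 := map_ofNat C 2
  have n3 : (C 3 : MvPolynomial (Fin 4) ℂ) = 3 := map_ofNat C 3
  have n6 : (C 6 : MvPolynomial (Fin 4) ℂ) = 6 := map_ofNat C 6
  have f2 : φ 2 = 2 := map_ofNat φ 2
  have f4 : φ 4 = 4 := map_ofNat φ 4
  have f8 : φ 8 = 8 := map_ofNat φ 8
  fin_cases k <;>
  · simp [p, f2, f4, f8, e0, e1, e2, e3, e4, e5, e6, e7, eC, z, n2, n3, n6]
    generalize (C q : MvPolynomial (Fin 4) ℂ) = Q at *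
    ring_nf
    try simp only [h2, h3, h4]
    try ring

/-- the weights of `z₁,…,z₈` -/
def wt : Fin 8 → ℕ := ![2, 4, 4, 4, 4, 6, 6, 6]

attribute [local instance] MvPolynomial.weightedGradedAlgebra

theorem p_homog (k : Fin 9) : ∃ n, IsWeightedHomogeneous wt (p k) n := by
  have x0 : IsWeightedHomogeneous wt (X 0 : MvPolynomial (Fin 8) ℂ) 2 := isWeightedHomogeneous_X ℂ wt 0
  have x1 : IsWeightedHomogeneous wt (X 1 : MvPolynomial (Fin 8) ℂ) 4 := isWeightedHomogeneous_X ℂ wt 1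
  have x2 : IsWeightedHomogeneous wt (X 2 : MvPolynomial (Fin 8) ℂ) 4 := isWeightedHomogeneous_X ℂ wt 2
  have x3 : IsWeightedHomogeneous wt (X 3 : MvPolynomial (Fin 8) ℂ) 4 := isWeightedHomogeneous_X ℂ wt 3
  have x4 : IsWeightedHomogeneous wt (X 4 : MvPolynomial (Fin 8) ℂ) 4 := isWeightedHomogeneous_X ℂ wt 4
  have x5 : IsWeightedHomogeneous wt (X 5 : MvPolynomial (Fin 8) ℂ) 6 := isWeightedHomogeneous_X ℂ wt 5
  have x6 : IsWeightedHomogeneous wt (X 6 : MvPolynomial (Fin 8) ℂ) 6 := isWeightedHomogeneous_X ℂ wt 6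
  have x7 : IsWeightedHomogeneous wt (X 7 : MvPolynomial (Fin 8) ℂ) 6 := isWeightedHomogeneous_X ℂ wt 7
  have cc : ∀ c : ℂ, IsWeightedHomogeneous wt (C c : MvPolynomial (Fin 8) ℂ) 0 :=
    isWeightedHomogeneous_C wt
  have n2 : IsWeightedHomogeneous wt (2 : MvPolynomial (Fin 8) ℂ) 0 := cc 2
  have n4 : IsWeightedHomogeneous wt (4 : MvPolynomial (Fin 8) ℂ) 0 := cc 4
  have n8 : IsWeightedHomogeneous wt (8 : MvPolynomial (Fin 8) ℂ) 0 := cc 8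
  have whSub : ∀ {f g : MvPolynomial (Fin 8) ℂ} {m n : ℕ}, IsWeightedHomogeneous wt f m →
      IsWeightedHomogeneous wt g n → m = n → IsWeightedHomogeneous wt (f - g) m := by
    intro f g m n hf hg e
    subst e
    exact Submodule.sub_mem (weightedHomogeneousSubmodule ℂ wt m) hf hg
  have whAdd : ∀ {f g : MvPolynomial (Fin 8) ℂ} {m n : ℕ}, IsWeightedHomogeneous wt f m →
      IsWeightedHomogeneous wt g n → m = n → IsWeightedHomogeneous wt (f + g) m := by
    intro f g m n hf hg e
    subst e
    exact hf.add hg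
  have whNeg : ∀ {f : MvPolynomial (Fin 8) ℂ} {m : ℕ}, IsWeightedHomogeneous wt f m →
      IsWeightedHomogeneous wt (-f) m := by
    intro f m hf
    exact Submodule.neg_mem (weightedHomogeneousSubmodule ℂ wt m) hf
  fin_cases k
  · exact ⟨_, whSub (whSub (whSub (((cc _).mul (x0.pow 3)).mul x4) ((x0.mul x2).mul x3) rfl)
      ((n2.mul x1).mul x5) rfl) (x4.mul x7) rfl⟩
  · exact ⟨_, whAdd (whAdd (x0.mul (x4.pow 2)) ((n2.mul x3).mul x5) rfl) (x2.mul x7) rfl⟩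
  · exact ⟨_, whSub (whSub (whAdd (((cc _).mul (x0.pow 3)).mul x3) ((x0.mul x1).mul x4) rfl)
      ((n2.mul x2).mul x6) rfl) (x3.mul x7) rfl⟩
  · exact ⟨_, whSub (whSub (x0.mul (x3.pow 2)) ((n2.mul x4).mul x6) rfl) (x1.mul x7) rfl⟩
  · exact ⟨_, whSub (whSub (whAdd (whNeg (x0.pow 4)) (x1.mul x2) rfl) (x3.mul x4) rfl)
      (((cc _).mul x0).mul x7) rfl⟩
  · exact ⟨_, whSub (whAdd (whSub (whSub ((((cc _).mul (x0.pow 2)).mul x2).mul x4)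
      ((n2.mul (x0.pow 3)).mul x5) rfl) ((x2.pow 2).mul x3) rfl) (x4.pow 3) rfl)
      (((cc _).mul x5).mul x7) rfl⟩
  · exact ⟨_, whSub (whAdd (whAdd (((x0.pow 2).mul x3).mul x4) (((cc _).mul (x0.pow 3)).mul x7) rfl)
      ((n4.mul x5).mul x6) rfl) (x7.pow 2) rfl⟩
  · exact ⟨_, whSub (whAdd (whSub (whSub ((((cc _).mul (x0.pow 2)).mul x1).mul x3)
      ((n2.mul (x0.pow 3)).mul x6) rfl) (x3.pow 3) rfl) ((x1.pow 2).mul x4) rfl)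
      (((cc _).mul x6).mul x7) rfl⟩
  · exact ⟨_, whAdd (whAdd (whSub (whAdd (((n4.mul (x0.pow 2)).mul x3).mul x4)
      (((cc _).mul x2).mul (x3.pow 2)) rfl) (((cc _).mul x1).mul (x4.pow 2)) rfl)
      ((n4.mul x5).mul x6) rfl) (n8.mul (x7.pow 2)) rfl⟩

theorem I_homog :
    (Ideal.span (Set.range p)).IsHomogeneous (weightedHomogeneousSubmodule ℂ wt) := by
  apply Ideal.homogeneous_span
  rintro _ ⟨k, rfl⟩
  exact p_homog k

/-- Krull-type argument: only the homogeneity of the ideal is used -/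
theorem mem_of_forall (f : MvPolynomial (Fin 8) ℂ)
    (h : ∀ n : ℕ, ∃ g, f - X 0 ^ n * g ∈ Ideal.span (Set.range p)) :
    f ∈ Ideal.span (Set.range p) := by
  rw [mem_iff_weightedHomogeneousComponent_mem ℂ wt I_homog]
  intro d
  obtain ⟨g, hg⟩ := h (d + 1)
  have h1 := weightedHomogeneousComponent_mem_of_mem ℂ wt I_homog hg d
  have h2 : weightedHomogeneousComponent wt d (X 0 ^ (d + 1) * g) = 0 := by
    ext e
    rw [coeff_weightedHomogeneousComponent, coeff_zero, X_pow_eq_monomial, coeff_monomial_mul']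
    split_ifs with ha hb
    · exfalso
      have e0 : d + 1 ≤ e 0 := by simpa using hb 0
      have : e 0 * 2 ≤ Finsupp.weight wt e := by
        rw [Finsupp.weight_apply, Finsupp.sum_fintype _ _ (by simp)]
        have := Finset.single_le_sum (f := fun i => e i • wt i) (fun i _ => Nat.zero_le _)
          (Finset.mem_univ (0 : Fin 8))
        simpa [wt] using this
      omega
    · rfl
    · rfl
  rw [map_sub, h2, sub_zero] at h1
  exact h1

theorem mod_z1 (f : MvPolynomial (Fin 8) ℂ) (hf : φ f = 0) :
    f ∈ Ideal.span (Set.range p) ⊔ Ideal.span {X 0} := by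
  let J : Ideal (MvPolynomial (Fin 8) ℂ) := Ideal.span (Set.range p) ⊔ Ideal.span {X 0}
  let ev := Ideal.Quotient.mkₐ ℂ J
  have hp : ∀ k, ev (p k) = 0 := fun k => by
    apply Ideal.Quotient.eq_zero_iff_mem.mpr
    exact Ideal.mem_sup_left (Ideal.subset_span ⟨k, rfl⟩)
  have h0 : ev (X 0) = 0 := by
    apply Ideal.Quotient.eq_zero_iff_mem.mpr
    exact Ideal.mem_sup_right (Ideal.subset_span rfl)
  let v : MvPolynomial (Fin 8) ℂ ⧸ J := algebraMap ℂ _ (-1 / 2) * ev (X 7)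
  have hh : algebraMap ℂ (MvPolynomial (Fin 8) ℂ ⧸ J) (-1 / 2) * 2 = -1 := by
    have : (2 : MvPolynomial (Fin 8) ℂ ⧸ J) = algebraMap ℂ _ 2 := (map_ofNat _ 2).symm
    rw [this, ← map_mul]; norm_num
  have h7 : ev (X 7) = (-2 : ℂ) • v := by
    rw [Algebra.smul_def, ← mul_assoc, ← map_mul]; norm_num
  obtain ⟨u, hu⟩ := rr_dvd (th f) (fun a b t => by rw [th_eval, hf, map_zero])
  have P0 := hp 0
  have P1 := hp 1
  have P2 := hp 2
  have P3 := hp 3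
  have P4 := hp 4
  have P6 := hp 6
  simp [p, h0] at P0 P1 P2 P3 P4 P6
  have e4 : ev 4 = 4 := map_ofNat ev 4
  have e2 : ev 2 = 2 := map_ofNat ev 2
  rw [e2] at P0 P1 P2 P3
  rw [e4] at P6
  have hS : Scroll (ev (X 4)) (ev (X 1)) (ev (X 2)) (ev (X 3)) (ev (X 5)) v (ev (X 6)) := by
    generalize hK : algebraMap ℂ (MvPolynomial (Fin 8) ℂ ⧸ J) (-1 / 2) = K at hh
    have hv : v = K * ev (X 7) := by rw [← hK]
    rw [hv]
    constructor
    · linear_combination -P4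
    · linear_combination (-K) * P0 - ev (X 1) * ev (X 5) * hh
    · linear_combination K * P3 + ev (X 4) * ev (X 6) * hh
    · linear_combination K * P1 - ev (X 3) * ev (X 5) * hh
    · linear_combination K * P2 + ev (X 2) * ev (X 6) * hh
    · linear_combination (-K ^ 2) * P6 + ev (X 5) * ev (X 6) * (2 * K - 1) * hh
  have h2 : (C q : MvPolynomial (Fin 4) ℂ) ^ 2 = -3 := Cq_sq
  have n3 : (C (q / 3) : MvPolynomial (Fin 4) ℂ) * 3 = C q := by
    have : (3 : MvPolynomial (Fin 4) ℂ) = C 3 := (map_ofNat C 3).symm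
    rw [this, ← C_mul]; congr 1; field_simp
  have hK3 : (C (q / 3) : MvPolynomial (Fin 4) ℂ) * C q = -1 := by
    have : q / 3 * q = -1 := by linear_combination (1 / 3) * q_sq
    rw [← C_mul, this]; simp
  have n12 : (C 12 : MvPolynomial (Fin 4) ℂ) = 12 := map_ofNat C 12
  have n2 : (C 2 : MvPolynomial (Fin 4) ℂ) = 2 := map_ofNat C 2
  have n6 : (C 6 : MvPolynomial (Fin 4) ℂ) = 6 := map_ofNat C 6
  have t0 : th (X 0) = 0 := by rw [th, aeval_X]; rfl
  have tC : ∀ c : ℂ, th (C c) = C c := fun c => by simp [th]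
  have f2 : th 2 = 2 := map_ofNat th 2
  have f4 : th 4 = 4 := map_ofNat th 4
  have f8 : th 8 = 8 := map_ofNat th 8
  have hz := ev_zero ev v h0 h7 hS ![p 5, C (q / 3) * p 8, p 7]
    (by intro k; fin_cases k <;> simp [hp])
    (by
      intro k
      fin_cases k
      · simp [p, f2, f4, f8, t0, th_X1, th_X2, th_X3, th_X4, th_X5, th_X6, th_X7, tC, rr, n2, n6, n12]
        ring
      · simp [p, f2, f4, f8, t0, th_X1, th_X2, th_X3, th_X4, th_X5, th_X6, th_X7, tC, rr, n2, n6, n12, -map_div₀]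
        linear_combination (X 3^2*X 1^3 - X 3*X 0^3)*hK3 + 12*X 3^2*X 2^2*n3
      · simp [p, f2, f4, f8, t0, th_X1, th_X2, th_X3, th_X4, th_X5, th_X6, th_X7, tC, rr, n2, n6, n12]
        ring)
    f u hu
  exact Ideal.Quotient.eq_zero_iff_mem.mp hz

theorem iterate_z1 (n : ℕ) (f : MvPolynomial (Fin 8) ℂ) (hf : φ f = 0) :
    ∃ g, φ g = 0 ∧ f - X 0 ^ n * g ∈ Ideal.span (Set.range p) := by
  induction n with
  | zero => exact ⟨f, hf, by simp⟩
  | succ n ih =>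
    obtain ⟨g, hg, hfg⟩ := ih
    obtain ⟨i, hi, y, hy, hiy⟩ := Submodule.mem_sup.mp (mod_z1 g hg)
    obtain ⟨g', rfl⟩ := Ideal.mem_span_singleton'.mp hy
    refine ⟨g', ?_, ?_⟩
    · have hi0 : φ i = 0 := by
        have : Ideal.span (Set.range p) ≤ RingHom.ker φ := by
          rw [Ideal.span_le]
          rintro _ ⟨k, rfl⟩
          exact p_mem_ker k
        exact this hi
      have h1 : φ g' * φ (X 0) = 0 := by
        rw [← map_mul, ← hg, ← hiy, map_add, hi0, zero_add]
      rcases mul_eq_zero.mp h1 with h | h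
      · exact h
      · exfalso
        have e0 : φ (X 0) = X 0 * X 2 + X 1 * X 3 := aeval_X z 0
        rw [e0] at h
        have := congrArg (eval ![1, 0, 1, 0]) h
        simp at this
    · have : f - X 0 ^ (n + 1) * g' = (f - X 0 ^ n * g) + X 0 ^ n * i := by
        rw [← hiy]; ring
      rw [this]
      exact Ideal.add_mem _ hfg (Ideal.mul_mem_left _ _ hi)

theorem kernel_eq_span_relations :
    RingHom.ker φ = Ideal.span (Set.range p) := by
  apply le_antisymm
  · intro f hf
    apply mem_of_forall
    intro n
    obtain ⟨g, -, hg⟩ := iterate_z1 n f hf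
    exact ⟨g, hg⟩
  · rw [Ideal.span_le]
    rintro _ ⟨k, rfl⟩
    exact p_mem_ker k


end
end
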